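/- Assuming the condition a^{1/4} · max_{(T,x)∈D} ∫_I (U(x,ξ)/ξ) tanh(ξ/(2T)) dξ ≤ 1, one has sup_{f∈W} max_{(T,x)∈D} ( −(Af)_T(T,x) ) ≤ sup_{f∈W} max_{(T,x)∈D} ( −f_T(T,x) ) = M_T. -/

import Mathlib

open Set MeasureTheory Filter Topology

noncomputable section

/-- The context of the BCS-Bogoliubov model: the cutoff `eps`, the Debye energy `om = ℏω_D`,
the potential `U` with bounds `U₁ ≤ U ≤ U₂`, the constant `a`, the temperatures
`tau₁, tau₂, T₀, Tc`, the solutions `Δ₁, Δ₂` of the constant-potential gap equations,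
the constant `Mz = max_{z ≥ 0} z / cosh z` and the constant `MT = M_T`. -/
structure BCSContext where
  eps : ℝ
  om : ℝ
  U : ℝ → ℝ → ℝ
  U₁ : ℝ
  U₂ : ℝ
  Umax : ℝ
  Umin : ℝ
  a : ℝ
  tau₁ : ℝ
  tau₂ : ℝ
  Δ₁ : ℝ → ℝ
  Δ₂ : ℝ → ℝ
  Tc : ℝ
  T₀ : ℝ
  Mz : ℝ
  MT : ℝ
  heps : 0 < eps
  hepsom : eps < om
  hU₁pos : 0 < U₁
  hU₁₂ : U₁ ≤ U₂
  hUsmooth : ContDiffOn ℝ 2 (fun p : ℝ × ℝ => U p.1 p.2) (Icc eps om ×ˢ Icc eps om)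
  hUlb : ∀ x ∈ Icc eps om, ∀ ξ ∈ Icc eps om, U₁ ≤ U x ξ
  hUub : ∀ x ∈ Icc eps om, ∀ ξ ∈ Icc eps om, U x ξ ≤ U₂
  hUmax : IsGreatest (Set.image2 U (Icc eps om) (Icc eps om)) Umax
  hUmin : IsLeast (Set.image2 U (Icc eps om) (Icc eps om)) Umin
  ha : a = (Umax / Umin) ^ 2
  htau₁pos : 0 < tau₁
  htau₂pos : 0 < tau₂
  htau₁ : 1 = U₁ * (∫ ξ in eps..om, Real.tanh (ξ / (2 * tau₁)) / ξ)
  htau₂ : 1 = U₂ * (∫ ξ in eps..om, Real.tanh (ξ / (2 * tau₂)) / ξ)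
  hΔ₁nonneg : ∀ T, 0 ≤ Δ₁ T
  hΔ₂nonneg : ∀ T, 0 ≤ Δ₂ T
  hΔ₁cont : Continuous Δ₁
  hΔ₂cont : Continuous Δ₂
  hΔ₁anti : StrictAntiOn Δ₁ (Icc 0 tau₁)
  hΔ₂anti : StrictAntiOn Δ₂ (Icc 0 tau₂)
  hΔ₁eq : ∀ T ∈ Ioc 0 tau₁, U₁ * (∫ ξ in eps..om,
      Real.tanh (Real.sqrt (ξ ^ 2 + Δ₁ T ^ 2) / (2 * T)) / Real.sqrt (ξ ^ 2 + Δ₁ T ^ 2)) = 1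
  hΔ₂eq : ∀ T ∈ Ioc 0 tau₂, U₂ * (∫ ξ in eps..om,
      Real.tanh (Real.sqrt (ξ ^ 2 + Δ₂ T ^ 2) / (2 * T)) / Real.sqrt (ξ ^ 2 + Δ₂ T ^ 2)) = 1
  hΔ₁zero : ∀ T, tau₁ ≤ T → Δ₁ T = 0
  hΔ₂zero : ∀ T, tau₂ ≤ T → Δ₂ T = 0
  hTc₁ : tau₁ ≤ Tc
  hTc₂ : Tc ≤ tau₂
  hT₀₁ : tau₁ < T₀
  hT₀₂ : T₀ < Tc
  hMz : IsGreatest ((fun z => z / Real.cosh z) '' Set.Ici (0 : ℝ)) Mz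
  hMT : MT = 4 * a * U₂ * Mz ^ 2 /
      (eps * U₁ *
        (Real.tanh (eps / (2 * Tc)) - (eps / (2 * Tc)) / Real.cosh (eps / (2 * Tc)) ^ 2) *
        (∫ ξ in eps..om, (ξ ^ 2 + Δ₂ 0 ^ 2) ^ (-(3 : ℝ) / 2)))

namespace BCSContext

/-- The energy interval `I = [ε, ℏω_D]`. -/
def Iset (C : BCSContext) : Set ℝ := Icc C.eps C.om

/-- The rectangle `D = [T₀, T_c] × I`. -/
def Dset (C : BCSContext) : Set (ℝ × ℝ) := Icc C.T₀ C.Tc ×ˢ Icc C.eps C.om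

end BCSContext

/-- The operator `A` of the squared BCS-Bogoliubov gap equation. -/
def opA (C : BCSContext) (f : ℝ → ℝ → ℝ) (T x : ℝ) : ℝ :=
  (∫ ξ in C.eps..C.om, C.U x ξ * Real.sqrt (f T ξ / (ξ ^ 2 + f T ξ)) *
      Real.tanh (Real.sqrt (ξ ^ 2 + f T ξ) / (2 * T))) ^ 2

/-- Partial derivative with respect to the temperature `T` (within `[T₀, T_c]`). -/
def pderivT (C : BCSContext) (g : ℝ → ℝ → ℝ) (T x : ℝ) : ℝ :=
  derivWithin (fun s => g s x) (Icc C.T₀ C.Tc) T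

/-- Partial derivative with respect to the energy `x` (within `I = [ε, ℏω_D]`). -/
def pderivX (C : BCSContext) (g : ℝ → ℝ → ℝ) (T x : ℝ) : ℝ :=
  derivWithin (fun y => g T y) (Icc C.eps C.om) x

/-- Membership in the set `W`. -/
def memW (C : BCSContext) (f : ℝ → ℝ → ℝ) : Prop :=
  ContDiffOn ℝ 2 (fun p : ℝ × ℝ => f p.1 p.2) C.Dset ∧
  (∀ T ∈ Icc C.T₀ C.Tc, ∀ x ∈ C.Iset, C.Δ₁ T ^ 2 ≤ f T x ∧ f T x ≤ C.Δ₂ T ^ 2) ∧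
  (∀ x ∈ C.Iset, f C.Tc x = 0) ∧
  (∀ T ∈ Ico C.T₀ C.Tc, ∀ x ∈ C.Iset, ∀ x₁ ∈ C.Iset, f T x ≤ C.a * f T x₁) ∧
  (∀ x ∈ C.Iset, ∀ x₁ ∈ C.Iset,
      -(pderivT C f C.Tc x) ≤ C.a * -(pderivT C f C.Tc x₁)) ∧
  (∀ T ∈ Icc C.T₀ C.Tc, ∀ x ∈ C.Iset, pderivT C f T x < 0) ∧
  (∀ T ∈ Icc C.T₀ C.Tc, ∀ x ∈ C.Iset, -(pderivT C f T x) ≤ C.MT)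

/-- The condition `a^{1/4} · max_{(T,x) ∈ D} ∫_I (U(x,ξ)/ξ) tanh(ξ/(2T)) dξ ≤ 1`. -/
def gapCondition (C : BCSContext) : Prop :=
  ∀ T ∈ Icc C.T₀ C.Tc, ∀ x ∈ C.Iset,
    C.a ^ ((1 : ℝ) / 4) * (∫ ξ in C.eps..C.om, C.U x ξ / ξ * Real.tanh (ξ / (2 * T))) ≤ 1

instance (C : BCSContext) : CompactSpace ↥C.Dset :=
  isCompact_iff_compactSpace.mp (isCompact_Icc.prod isCompact_Icc)

-- Extension of a continuous function on `D` to a function on `ℝ × ℝ` (by `0` outside `D`).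
open Classical in
def extFun (C : BCSContext) (F : C(↥C.Dset, ℝ)) : ℝ → ℝ → ℝ :=
  fun T x => if h : (T, x) ∈ C.Dset then F ⟨(T, x), h⟩ else 0

/-- The set `W` regarded as a subset of the Banach space `C(D)`. -/
def WSet (C : BCSContext) : Set C(↥C.Dset, ℝ) :=
  {F | ∃ f : ℝ → ℝ → ℝ, memW C f ∧ ∀ p : ↥C.Dset, F p = f (p : ℝ × ℝ).1 (p : ℝ × ℝ).2}


theorem Real.hasDerivAt_tanh (z : ℝ) : HasDerivAt Real.tanh (1 / Real.cosh z ^ 2) z := by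
  have hc : Real.cosh z ≠ 0 := (Real.cosh_pos z).ne'
  have h := (Real.hasDerivAt_sinh z).div (Real.hasDerivAt_cosh z) hc
  have he : Real.tanh = Real.sinh / Real.cosh := funext Real.tanh_eq_sinh_div_cosh
  rw [he]
  refine h.congr_deriv ?_
  congr 1
  nlinarith [Real.cosh_sq z]

theorem Real.continuous_tanh : Continuous Real.tanh :=
  continuous_iff_continuousAt.2 fun z => (Real.hasDerivAt_tanh z).continuousAt

theorem Real.strictMono_tanh : StrictMono Real.tanh :=
  strictMono_of_hasDerivAt_pos Real.hasDerivAt_tanh fun z => by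
    have := Real.cosh_pos z
    positivity

theorem Real.tanh_pos {z : ℝ} (hz : 0 < z) : 0 < Real.tanh z := by
  simpa using Real.strictMono_tanh hz

theorem Real.tanh_nonneg {z : ℝ} (hz : 0 ≤ z) : 0 ≤ Real.tanh z := by
  simpa using Real.strictMono_tanh.monotone hz

/-- The function `z ↦ tanh z - z / cosh² z` controlling the derivative of `tanh z / z`. -/
def tanhDefect (z : ℝ) : ℝ := Real.tanh z - z / Real.cosh z ^ 2

theorem hasDerivAt_tanhDefect (z : ℝ) :
    HasDerivAt tanhDefect (2 * z * Real.sinh z / Real.cosh z ^ 3) z := by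
  have hc : Real.cosh z ≠ 0 := (Real.cosh_pos z).ne'
  have h := (Real.hasDerivAt_tanh z).sub
    ((hasDerivAt_id z).div ((Real.hasDerivAt_cosh z).pow 2) (pow_ne_zero 2 hc))
  refine HasDerivAt.congr_deriv (f := tanhDefect) h ?_
  simp only [id, Pi.pow_apply, Nat.cast_ofNat]
  field_simp
  ring

theorem strictMonoOn_tanhDefect : StrictMonoOn tanhDefect (Ici 0) := by
  refine strictMonoOn_of_deriv_pos (convex_Ici 0)
    (fun z _ => (hasDerivAt_tanhDefect z).continuousAt.continuousWithinAt) fun z hz => ?_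
  rw [interior_Ici] at hz
  rw [(hasDerivAt_tanhDefect z).deriv]
  have h1 : 0 < z := hz
  have h2 := Real.sinh_pos_iff.2 h1
  have h3 := Real.cosh_pos z
  positivity

theorem tanhDefect_pos {z : ℝ} (hz : 0 < z) : 0 < tanhDefect z := by
  have := strictMonoOn_tanhDefect (mem_Ici.2 le_rfl) (mem_Ici.2 hz.le) hz
  simpa [tanhDefect] using this

theorem antitoneOn_tanh_div : AntitoneOn (fun z => Real.tanh z / z) (Ioi 0) := by
  have hd : ∀ z ∈ Ioi (0 : ℝ),
      HasDerivAt (fun z => Real.tanh z / z) (-(tanhDefect z) / z ^ 2) z := by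
    intro z hz
    have hz' : z ≠ 0 := (mem_Ioi.1 hz).ne'
    have h := (Real.hasDerivAt_tanh z).div (hasDerivAt_id z) hz'
    refine HasDerivAt.congr_deriv (f := fun z => Real.tanh z / z) h ?_
    simp only [id, tanhDefect]
    ring
  refine antitoneOn_of_deriv_nonpos (convex_Ioi 0)
    (fun z hz => (hd z hz).continuousAt.continuousWithinAt)
    (fun z hz => (hd z (interior_subset hz)).differentiableAt.differentiableWithinAt)
    fun z hz => ?_
  rw [(hd z (interior_subset hz)).deriv]
  have := tanhDefect_pos (interior_subset hz : z ∈ Ioi (0 : ℝ))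
  exact div_nonpos_of_nonpos_of_nonneg (by linarith) (sq_nonneg z)

theorem tanh_sub_tanh_ge {u v : ℝ} (hv : 0 ≤ v) (huv : v ≤ u) :
    (u - v) / Real.cosh u ^ 2 ≤ Real.tanh u - Real.tanh v := by
  have h := (convex_Icc v u).mul_sub_le_image_sub_of_le_deriv (f := Real.tanh)
    (C := 1 / Real.cosh u ^ 2) Real.continuous_tanh.continuousOn
    (fun z _ => (Real.hasDerivAt_tanh z).differentiableAt.differentiableWithinAt)
    (fun z hz => by
      rw [interior_Icc] at hz
      rw [(Real.hasDerivAt_tanh z).deriv]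
      have hc := Real.cosh_pos z
      have : Real.cosh z ≤ Real.cosh u := by
        rw [Real.cosh_le_cosh, abs_of_nonneg (by linarith [hz.1]), abs_of_nonneg (by linarith)]
        exact hz.2.le
      gcongr) v (left_mem_Icc.2 huv) u (right_mem_Icc.2 huv) huv
  calc _ = 1 / Real.cosh u ^ 2 * (u - v) := by ring
    _ ≤ _ := h

theorem tanh_div_two_mul_div_le {ξ E T : ℝ} (hξ : 0 < ξ) (hE : ξ ≤ E) (hT : 0 < T) :
    Real.tanh (E / (2 * T)) / E ≤ Real.tanh (ξ / (2 * T)) / ξ := by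
  have hE0 : 0 < E := hξ.trans_le hE
  have h := antitoneOn_tanh_div (mem_Ioi.2 (by positivity : 0 < ξ / (2 * T)))
    (mem_Ioi.2 (by positivity : 0 < E / (2 * T))) (by gcongr)
  have e1 : Real.tanh (E / (2 * T)) / E = Real.tanh (E / (2 * T)) / (E / (2 * T)) / (2 * T) := by
    field_simp
  have e2 : Real.tanh (ξ / (2 * T)) / ξ = Real.tanh (ξ / (2 * T)) / (ξ / (2 * T)) / (2 * T) := by
    field_simp
  rw [e1, e2]
  exact div_le_div_of_nonneg_right h (by positivity)

/-- The integrand of `opA` without the potential, at energy `ξ`, temperature `T` and squared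
gap `y`. -/
def gapKernel (ξ T y : ℝ) : ℝ :=
  Real.sqrt (y / (ξ ^ 2 + y)) * Real.tanh (Real.sqrt (ξ ^ 2 + y) / (2 * T))

/-- The total temperature derivative of `gapKernel`, where `y'` is the temperature derivative of
the squared gap. -/
def gapKernelDeriv (ξ T y y' : ℝ) : ℝ :=
  y' / (2 * Real.sqrt y) *
      (ξ ^ 2 * Real.tanh (Real.sqrt (ξ ^ 2 + y) / (2 * T)) / Real.sqrt (ξ ^ 2 + y) ^ 3 +
        y / (2 * T * Real.sqrt (ξ ^ 2 + y) ^ 2 *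
          Real.cosh (Real.sqrt (ξ ^ 2 + y) / (2 * T)) ^ 2)) -
    Real.sqrt y / (2 * T ^ 2 * Real.cosh (Real.sqrt (ξ ^ 2 + y) / (2 * T)) ^ 2)

theorem hasDerivAt_gapKernel {f : ℝ → ℝ} {f' ξ s : ℝ} (hf : HasDerivAt f f' s)
    (hpos : 0 < f s) (hs : 0 < s) :
    HasDerivAt (fun t => gapKernel ξ t (f t)) (gapKernelDeriv ξ s (f s) f') s := by
  have hE2 : 0 < ξ ^ 2 + f s := by positivity
  have hadd : HasDerivAt (fun t => ξ ^ 2 + f t) f' s := hf.const_add (ξ ^ 2)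
  have h1 : HasDerivAt (fun t => Real.sqrt (f t / (ξ ^ 2 + f t))) _ s :=
    (hf.div hadd hE2.ne').sqrt (div_pos hpos hE2).ne'
  have h2 : HasDerivAt (fun t => Real.sqrt (ξ ^ 2 + f t) / (2 * t)) _ s :=
    (hadd.sqrt hE2.ne').div ((hasDerivAt_id s).const_mul 2) (by simpa using hs.ne')
  have h3 : HasDerivAt (fun t => Real.tanh (Real.sqrt (ξ ^ 2 + f t) / (2 * t))) _ s :=
    (Real.hasDerivAt_tanh _).comp s h2
  have h4 := h1.mul h3
  refine HasDerivAt.congr_deriv (f := fun t => gapKernel ξ t (f t)) h4 ?_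
  simp only [gapKernelDeriv, Pi.div_apply]
  rw [Real.sqrt_div hpos.le]
  set E := Real.sqrt (ξ ^ 2 + f s) with hE
  set r := Real.sqrt (f s) with hr
  have hE0 : 0 < E := Real.sqrt_pos.2 hE2
  have hr0 : 0 < r := Real.sqrt_pos.2 hpos
  have hEE : ξ ^ 2 + f s = E ^ 2 := (Real.sq_sqrt hE2.le).symm
  have hrr : f s = r ^ 2 := (Real.sq_sqrt hpos.le).symm
  have hc := Real.cosh_pos (E / (2 * s))
  have hξ : ξ ^ 2 = E ^ 2 - r ^ 2 := by linarith
  rw [hEE, hrr, hξ]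
  field_simp
  ring

theorem gapKernel_nonneg {ξ T y : ℝ} (hT : 0 < T) : 0 ≤ gapKernel ξ T y :=
  mul_nonneg (Real.sqrt_nonneg _) (Real.tanh_nonneg (by positivity))

theorem gapKernel_le_one {ξ T y : ℝ} (hy : 0 ≤ y) (hT : 0 < T) : gapKernel ξ T y ≤ 1 := by
  refine mul_le_one₀ ?_ (Real.tanh_nonneg (by positivity)) (Real.tanh_lt_one _).le
  rw [Real.sqrt_le_one]
  exact div_le_one_of_le₀ (by nlinarith [sq_nonneg ξ]) (by positivity)

theorem gapKernel_le {ξ T y M : ℝ} (hξ : 0 < ξ) (hT : 0 < T) (hy : 0 ≤ y) (hM : y ≤ M) :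
    gapKernel ξ T y ≤ Real.sqrt M * (Real.tanh (ξ / (2 * T)) / ξ) := by
  have hE : ξ ≤ Real.sqrt (ξ ^ 2 + y) := Real.le_sqrt_of_sq_le (by linarith)
  calc gapKernel ξ T y
      = Real.sqrt y *
          (Real.tanh (Real.sqrt (ξ ^ 2 + y) / (2 * T)) / Real.sqrt (ξ ^ 2 + y)) := by
        rw [gapKernel, Real.sqrt_div hy]; ring
    _ ≤ _ := by
        refine mul_le_mul (Real.sqrt_le_sqrt hM) (tanh_div_two_mul_div_le hξ hE hT) ?_
          (Real.sqrt_nonneg _)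
        exact div_nonneg (Real.tanh_nonneg (by positivity)) (Real.sqrt_nonneg _)

theorem abs_gapKernelDeriv_le {ξ T y y' ε T₀ m M B : ℝ} (hε : 0 < ε) (hξ : ε ≤ ξ) (hT₀ : 0 < T₀)
    (hT : T₀ ≤ T) (hm : 0 < m) (hmy : m ≤ y) (hyM : y ≤ M) (hB : |y'| ≤ B) :
    |gapKernelDeriv ξ T y y'| ≤
      B / (2 * Real.sqrt m) * (1 / ε + 1 / (2 * T₀)) + Real.sqrt M / (2 * T₀ ^ 2) := by
  have hy : 0 < y := hm.trans_le hmy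
  have hξ0 : 0 < ξ := hε.trans_le hξ
  have hT0 : 0 < T := hT₀.trans_le hT
  have hB0 : 0 ≤ B := (abs_nonneg _).trans hB
  have hE : ξ ≤ Real.sqrt (ξ ^ 2 + y) := Real.le_sqrt_of_sq_le (by linarith)
  have hEE : Real.sqrt (ξ ^ 2 + y) ^ 2 = ξ ^ 2 + y := Real.sq_sqrt (by positivity)
  unfold gapKernelDeriv
  set E := Real.sqrt (ξ ^ 2 + y)
  have hE0 : 0 < E := hξ0.trans_le hE
  have hc : 1 ≤ Real.cosh (E / (2 * T)) ^ 2 := one_le_pow₀ (Real.one_le_cosh _)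
  have ht0 : 0 ≤ Real.tanh (E / (2 * T)) := Real.tanh_nonneg (by positivity)
  have ht1 : Real.tanh (E / (2 * T)) ≤ 1 := (Real.tanh_lt_one _).le
  have hr : 0 < Real.sqrt m := Real.sqrt_pos.2 hm
  have hrm : Real.sqrt m ≤ Real.sqrt y := Real.sqrt_le_sqrt hmy
  have hrM : Real.sqrt y ≤ Real.sqrt M := Real.sqrt_le_sqrt hyM
  refine (abs_sub _ _).trans (add_le_add ?_ ?_)
  · rw [abs_mul]
    refine mul_le_mul ?_ ?_ (abs_nonneg _) (by positivity)
    · rw [abs_div, abs_of_pos (by positivity : 0 < 2 * Real.sqrt y)]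
      gcongr
    · rw [abs_of_nonneg (by positivity)]
      refine add_le_add ?_ ?_
      · calc ξ ^ 2 * Real.tanh (E / (2 * T)) / E ^ 3 ≤ E ^ 2 * 1 / E ^ 3 := by gcongr
          _ = 1 / E := by field_simp
          _ ≤ 1 / ε := one_div_le_one_div_of_le hε (hξ.trans hE)
      · calc y / (2 * T * E ^ 2 * Real.cosh (E / (2 * T)) ^ 2)
            ≤ E ^ 2 / (2 * T₀ * E ^ 2 * 1) := by
              gcongr
              rw [hEE]; nlinarith [sq_nonneg ξ]
          _ = 1 / (2 * T₀) := by field_simp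
  · rw [abs_of_nonneg (by positivity)]
    calc Real.sqrt y / (2 * T ^ 2 * Real.cosh (E / (2 * T)) ^ 2)
        ≤ Real.sqrt M / (2 * T₀ ^ 2 * 1) := by gcongr
      _ = _ := by rw [mul_one]

theorem neg_gapKernelDeriv_le {ξ T y y' ε Tc Mz m M B Y : ℝ} (hε : 0 < ε) (hξ : ε ≤ ξ)
    (hT : 0 < T) (hTc : T ≤ Tc) (hm : 0 < m) (hmy : m ≤ y) (hyM : y ≤ M) (hyY : y ≤ Y)
    (hB : -y' ≤ B) (hB0 : 0 ≤ B) (hMz : ∀ z, 0 ≤ z → z / Real.cosh z ≤ Mz) :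
    -gapKernelDeriv ξ T y y' ≤
      B / (2 * Real.sqrt m) * (Real.tanh (ξ / (2 * T)) / ξ) -
        B * Real.sqrt m / 2 * tanhDefect (ε / (2 * Tc)) * (ξ ^ 2 + Y) ^ (-(3 : ℝ) / 2) +
        2 * Real.sqrt M * Mz ^ 2 * (ξ ^ 2)⁻¹ := by
  have hy : 0 < y := hm.trans_le hmy
  have hξ0 : 0 < ξ := hε.trans_le hξ
  have hTc0 : 0 < Tc := hT.trans_le hTc
  have hE : ξ ≤ Real.sqrt (ξ ^ 2 + y) := Real.le_sqrt_of_sq_le (by linarith)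
  have hEE : Real.sqrt (ξ ^ 2 + y) ^ 2 = ξ ^ 2 + y := Real.sq_sqrt (by positivity)
  have hrpow : (ξ ^ 2 + Y) ^ (-(3 : ℝ) / 2) ≤ 1 / Real.sqrt (ξ ^ 2 + y) ^ 3 := by
    have h1 : (ξ ^ 2 + Y) ^ (-(3 : ℝ) / 2) ≤ (ξ ^ 2 + y) ^ (-(3 : ℝ) / 2) :=
      Real.rpow_le_rpow_of_nonpos (by positivity) (by linarith) (by norm_num)
    have h2 : (ξ ^ 2 + y) ^ (-(3 : ℝ) / 2) = 1 / Real.sqrt (ξ ^ 2 + y) ^ 3 := by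
      rw [Real.sqrt_eq_rpow, ← Real.rpow_natCast ((ξ ^ 2 + y) ^ (1 / 2 : ℝ)) 3,
        ← Real.rpow_mul (by positivity), one_div,
        ← Real.rpow_neg (by positivity)]
      norm_num
    exact h1.trans h2.le
  have htanh := tanh_div_two_mul_div_le hξ0 hE hT
  unfold gapKernelDeriv
  set E := Real.sqrt (ξ ^ 2 + y)
  set P := (ξ ^ 2 + Y) ^ (-(3 : ℝ) / 2)
  have hE0 : 0 < E := hξ0.trans_le hE
  have hP : 0 ≤ P := Real.rpow_nonneg (by nlinarith [sq_nonneg ξ]) _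
  have hz : ε / (2 * Tc) ≤ E / (2 * T) := by
    have := hξ.trans hE
    gcongr
  have hG := strictMonoOn_tanhDefect.monotoneOn
    (mem_Ici.2 (by positivity : 0 ≤ ε / (2 * Tc))) (mem_Ici.2 (by positivity : 0 ≤ E / (2 * T))) hz
  have hG0 : 0 < tanhDefect (ε / (2 * Tc)) := tanhDefect_pos (by positivity)
  have hMzE := hMz (E / (2 * T)) (by positivity)
  have hc := Real.cosh_pos (E / (2 * T))
  have ht0 : 0 ≤ Real.tanh (E / (2 * T)) := Real.tanh_nonneg (by positivity)
  have hr : 0 < Real.sqrt m := Real.sqrt_pos.2 hm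
  have hrm : Real.sqrt m ≤ Real.sqrt y := Real.sqrt_le_sqrt hmy
  have hrM : Real.sqrt y ≤ Real.sqrt M := Real.sqrt_le_sqrt hyM
  set K := ξ ^ 2 * Real.tanh (E / (2 * T)) / E ^ 3 +
    y / (2 * T * E ^ 2 * Real.cosh (E / (2 * T)) ^ 2) with hK
  have hK0 : 0 ≤ K := by positivity
  have hKle : K ≤ Real.tanh (ξ / (2 * T)) / ξ - m * tanhDefect (ε / (2 * Tc)) * P := by
    have hKeq : K = Real.tanh (E / (2 * T)) / E - y * tanhDefect (E / (2 * T)) * (1 / E ^ 3) := by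
      rw [hK, show ξ ^ 2 = E ^ 2 - y by linarith, tanhDefect]
      field_simp
      ring
    have : m * tanhDefect (ε / (2 * Tc)) * P ≤ y * tanhDefect (E / (2 * T)) * (1 / E ^ 3) :=
      mul_le_mul (mul_le_mul hmy hG hG0.le hy.le) hrpow hP
        (mul_nonneg hy.le (hG0.le.trans hG))
    linarith
  have h1 : -y' / (2 * Real.sqrt y) * K ≤ B / (2 * Real.sqrt m) *
      (Real.tanh (ξ / (2 * T)) / ξ - m * tanhDefect (ε / (2 * Tc)) * P) := by
    refine mul_le_mul ?_ hKle hK0 (by positivity)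
    calc -y' / (2 * Real.sqrt y) ≤ B / (2 * Real.sqrt y) := by gcongr
      _ ≤ B / (2 * Real.sqrt m) := by gcongr
  have h2 : Real.sqrt y / (2 * T ^ 2 * Real.cosh (E / (2 * T)) ^ 2) ≤
      2 * Real.sqrt M * Mz ^ 2 * (ξ ^ 2)⁻¹ := by
    calc Real.sqrt y / (2 * T ^ 2 * Real.cosh (E / (2 * T)) ^ 2)
        = 2 * Real.sqrt y * (E / (2 * T) / Real.cosh (E / (2 * T))) ^ 2 * (E ^ 2)⁻¹ := by
          field_simp
      _ ≤ _ := by gcongr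
  have h3 : B / (2 * Real.sqrt m) * m = B * Real.sqrt m / 2 := by
    rw [div_mul_eq_mul_div, div_eq_div_iff (by positivity) (by norm_num)]
    linear_combination (-2 * B) * Real.mul_self_sqrt hm.le
  calc -(y' / (2 * Real.sqrt y) * K - Real.sqrt y / (2 * T ^ 2 * Real.cosh (E / (2 * T)) ^ 2))
      = -y' / (2 * Real.sqrt y) * K +
          Real.sqrt y / (2 * T ^ 2 * Real.cosh (E / (2 * T)) ^ 2) := by ring
    _ ≤ B / (2 * Real.sqrt m) *
          (Real.tanh (ξ / (2 * T)) / ξ - m * tanhDefect (ε / (2 * Tc)) * P) +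
        2 * Real.sqrt M * Mz ^ 2 * (ξ ^ 2)⁻¹ := add_le_add h1 h2
    _ = _ := by rw [← h3]; ring

namespace BCSContext

variable (C : BCSContext)

theorem T₀_pos : 0 < C.T₀ := C.htau₁pos.trans C.hT₀₁

theorem Tc_pos : 0 < C.Tc := C.T₀_pos.trans C.hT₀₂

theorem U₂_pos : 0 < C.U₂ := C.hU₁pos.trans_le C.hU₁₂

theorem eps_mem : C.eps ∈ C.Iset := left_mem_Icc.2 C.hepsom.le

theorem one_le_a : 1 ≤ C.a := by
  obtain ⟨⟨x, hx, y, hy, hxy⟩, hmin⟩ := C.hUmin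
  have h1 : 0 < C.Umin := hxy ▸ C.hU₁pos.trans_le (C.hUlb x hx y hy)
  have h2 : C.Umin ≤ C.Umax := hmin C.hUmax.1
  rw [C.ha]
  exact one_le_pow₀ ((one_le_div h1).2 h2)

theorem div_cosh_le_Mz {z : ℝ} (hz : 0 ≤ z) : z / Real.cosh z ≤ C.Mz :=
  C.hMz.2 ⟨z, hz, rfl⟩

theorem Mz_pos : 0 < C.Mz :=
  lt_of_lt_of_le (div_pos one_pos (Real.cosh_pos 1)) (C.div_cosh_le_Mz zero_le_one)

theorem continuousOn_rpow_neg (Y : ℝ) (hY : 0 ≤ Y) :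
    ContinuousOn (fun ξ : ℝ => (ξ ^ 2 + Y) ^ (-(3 : ℝ) / 2)) (Icc C.eps C.om) := by
  refine ContinuousOn.rpow_const (by fun_prop) fun ξ hξ => Or.inl ?_
  have := C.heps.trans_le hξ.1
  positivity

theorem integral_rpow_pos :
    0 < ∫ ξ in C.eps..C.om, (ξ ^ 2 + C.Δ₂ 0 ^ 2) ^ (-(3 : ℝ) / 2) := by
  refine intervalIntegral.intervalIntegral_pos_of_pos_on ?_ (fun ξ hξ => ?_) C.hepsom
  · exact (C.continuousOn_rpow_neg _ (sq_nonneg _)).intervalIntegrable_of_Icc C.hepsom.le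
  · have := C.heps.trans hξ.1
    positivity

theorem tanhDefect_eps_pos : 0 < tanhDefect (C.eps / (2 * C.Tc)) := by
  have := C.heps
  have := C.Tc_pos
  exact tanhDefect_pos (by positivity)

theorem MT_mul_eq :
    C.MT * (C.eps * C.U₁ * tanhDefect (C.eps / (2 * C.Tc)) *
      ∫ ξ in C.eps..C.om, (ξ ^ 2 + C.Δ₂ 0 ^ 2) ^ (-(3 : ℝ) / 2)) =
    4 * C.a * C.U₂ * C.Mz ^ 2 := by
  have h := C.hMT
  change C.MT = _ / (_ * tanhDefect (C.eps / (2 * C.Tc)) * _) at h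
  have h1 := C.heps
  have h2 := C.hU₁pos
  have h3 := C.tanhDefect_eps_pos
  have h4 := C.integral_rpow_pos
  rw [h, div_mul_cancel₀]
  positivity

theorem MT_pos : 0 < C.MT := by
  have h := C.hMT
  change C.MT = _ / (_ * tanhDefect (C.eps / (2 * C.Tc)) * _) at h
  have h1 := C.heps
  have h2 := C.hU₁pos
  have h3 := C.tanhDefect_eps_pos
  have h4 := C.integral_rpow_pos
  have h5 := C.U₂_pos
  have h6 := C.Mz_pos
  have h7 := C.one_le_a
  rw [h]
  positivity

theorem Δ₁_eq_zero {T : ℝ} (hT : T ∈ Icc C.T₀ C.Tc) : C.Δ₁ T = 0 :=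
  C.hΔ₁zero T (C.hT₀₁.le.trans hT.1)

theorem Δ₂_le_Δ₂_zero {T : ℝ} (hT : T ∈ Icc C.T₀ C.Tc) : C.Δ₂ T ≤ C.Δ₂ 0 :=
  C.hΔ₂anti.antitoneOn ⟨le_rfl, C.htau₂pos.le⟩
    ⟨C.T₀_pos.le.trans hT.1, hT.2.trans C.hTc₂⟩ (C.T₀_pos.le.trans hT.1)

/-- The squared gap `Δ₂²` vanishes at most linearly at its transition temperature. -/
theorem exists_linear_le_Δ₂_sq :
    ∃ c > 0, ∀ T ∈ Icc C.T₀ C.Tc, c * (C.Tc - T) ≤ C.Δ₂ T ^ 2 := by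
  have hε := C.heps
  have hτ := C.htau₂pos
  have hT₀ := C.T₀_pos
  have hom : 0 < C.om := hε.trans C.hepsom
  set q := Real.cosh (C.om / (2 * C.T₀)) ^ 2 with hq
  have hq0 : 0 < q := pow_pos (Real.cosh_pos _) 2
  refine ⟨2 * C.eps ^ 2 * (C.eps / (2 * C.tau₂ ^ 2 * q)), by positivity, fun T hT => ?_⟩
  have hT0 : 0 < T := hT₀.trans_le hT.1
  have hTτ : T ≤ C.tau₂ := hT.2.trans C.hTc₂
  set c := C.eps / (2 * C.tau₂ ^ 2 * q) with hc
  have hc0 : 0 < c := by positivity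
  suffices h : 2 * C.eps ^ 2 * c * (C.tau₂ - T) ≤ C.Δ₂ T ^ 2 by
    refine le_trans ?_ h
    have := C.hTc₂
    gcongr
  by_contra! hlt
  have hcontra : ∀ ξ ∈ Icc C.eps C.om, Real.tanh (ξ / (2 * C.tau₂)) / ξ <
      Real.tanh (Real.sqrt (ξ ^ 2 + C.Δ₂ T ^ 2) / (2 * T)) / Real.sqrt (ξ ^ 2 + C.Δ₂ T ^ 2) := by
    intro ξ hξ
    have hξ0 : 0 < ξ := hε.trans_le hξ.1
    set Y := C.Δ₂ T ^ 2 with hY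
    have hY0 : 0 ≤ Y := sq_nonneg _
    have hE : ξ ≤ Real.sqrt (ξ ^ 2 + Y) := Real.le_sqrt_of_sq_le (by linarith)
    have hE' : Real.sqrt (ξ ^ 2 + Y) ≤ ξ * (1 + Y / (2 * C.eps ^ 2)) := by
      refine Real.sqrt_le_iff.2 ⟨by positivity, ?_⟩
      have h1 : C.eps ^ 2 ≤ ξ ^ 2 := by gcongr; exact hξ.1
      have h2 : Y ≤ ξ ^ 2 * (Y / C.eps ^ 2) := by
        calc Y = C.eps ^ 2 * (Y / C.eps ^ 2) := by field_simp
          _ ≤ _ := by gcongr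
      calc ξ ^ 2 + Y ≤ ξ ^ 2 + ξ ^ 2 * (Y / C.eps ^ 2) := by linarith
        _ ≤ ξ ^ 2 + ξ ^ 2 * (Y / C.eps ^ 2) + ξ ^ 2 * (Y / (2 * C.eps ^ 2)) ^ 2 :=
          le_add_of_nonneg_right (by positivity)
        _ = _ := by field_simp; ring
    set E := Real.sqrt (ξ ^ 2 + Y) with hEdef
    have hE0 : 0 < E := hξ0.trans_le hE
    set v := ξ / (2 * C.tau₂) with hv
    have hv0 : 0 < v := by positivity
    have hvu : v ≤ ξ / (2 * T) := by rw [hv]; gcongr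
    have hmono : Real.tanh (ξ / (2 * T)) ≤ Real.tanh (E / (2 * T)) :=
      Real.strictMono_tanh.monotone (by gcongr)
    have hdiff : c * (C.tau₂ - T) ≤ Real.tanh (ξ / (2 * T)) - Real.tanh v := by
      refine le_trans ?_ (tanh_sub_tanh_ge hv0.le hvu)
      have h1 : ξ / (2 * T) - v = ξ * (C.tau₂ - T) / (2 * T * C.tau₂) := by
        rw [hv]; field_simp
      have h2 : Real.cosh (ξ / (2 * T)) ^ 2 ≤ q := by
        have : ξ / (2 * T) ≤ C.om / (2 * C.T₀) := by
          have := hξ.2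
          have := hT.1
          gcongr
        have h3 : Real.cosh (ξ / (2 * T)) ≤ Real.cosh (C.om / (2 * C.T₀)) := by
          rw [Real.cosh_le_cosh, abs_of_nonneg (by positivity), abs_of_nonneg (by positivity)]
          exact this
        have := Real.cosh_pos (ξ / (2 * T))
        rw [hq]; gcongr
      have hq' : 0 < Real.cosh (ξ / (2 * T)) ^ 2 := pow_pos (Real.cosh_pos _) 2
      have hs : 0 ≤ C.tau₂ - T := by linarith
      calc c * (C.tau₂ - T) = C.eps * (C.tau₂ - T) / (2 * C.tau₂ * C.tau₂) / q := by
            rw [hc]; field_simp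
        _ ≤ ξ * (C.tau₂ - T) / (2 * T * C.tau₂) / Real.cosh (ξ / (2 * T)) ^ 2 := by
            have := hξ.1
            gcongr
        _ = _ := by rw [h1]
    have hYlt : Y / (2 * C.eps ^ 2) < c * (C.tau₂ - T) := by
      rw [div_lt_iff₀ (by positivity)]
      linarith
    rw [div_lt_div_iff₀ hξ0 hE0]
    have ht0 : 0 < Real.tanh v := Real.tanh_pos hv0
    have ht1 : Real.tanh v < 1 := Real.tanh_lt_one v
    have hYn : 0 ≤ Y / (2 * C.eps ^ 2) := by positivity
    calc Real.tanh v * E ≤ Real.tanh v * (ξ * (1 + Y / (2 * C.eps ^ 2))) := by gcongr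
      _ = (Real.tanh v + Real.tanh v * (Y / (2 * C.eps ^ 2))) * ξ := by ring
      _ < Real.tanh (E / (2 * T)) * ξ := by
        refine mul_lt_mul_of_pos_right ?_ hξ0
        nlinarith
  have hcont1 : ContinuousOn (fun ξ => Real.tanh (ξ / (2 * C.tau₂)) / ξ) (Icc C.eps C.om) := by
    refine ContinuousOn.div (Real.continuous_tanh.comp (by fun_prop)).continuousOn
      continuousOn_id fun ξ hξ => (hε.trans_le hξ.1).ne'
  have hcont2 : ContinuousOn (fun ξ => Real.tanh (Real.sqrt (ξ ^ 2 + C.Δ₂ T ^ 2) / (2 * T)) /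
      Real.sqrt (ξ ^ 2 + C.Δ₂ T ^ 2)) (Icc C.eps C.om) := by
    refine ContinuousOn.div (Real.continuous_tanh.comp (by fun_prop)).continuousOn
      (by fun_prop) fun ξ hξ => ?_
    have := hε.trans_le hξ.1
    positivity
  have hint := intervalIntegral.integral_lt_integral_of_continuousOn_of_le_of_exists_lt
    C.hepsom hcont1 hcont2 (fun ξ hξ => (hcontra ξ (Ioc_subset_Icc_self hξ)).le)
    ⟨C.eps, C.eps_mem, hcontra _ C.eps_mem⟩
  have h1 := C.htau₂
  have h2 := C.hΔ₂eq T ⟨hT0, hTτ⟩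
  have h3 := mul_lt_mul_of_pos_left hint C.U₂_pos
  linarith

/-- Some member of `W` has the steepest slope `M_T` allowed in `W`. -/
theorem exists_memW_slope_eq_MT :
    ∃ f, memW C f ∧ -(pderivT C f C.T₀ C.eps) = C.MT := by
  obtain ⟨c, hc, hcle⟩ := C.exists_linear_le_Δ₂_sq
  have hM := C.MT_pos
  have hL : 0 < C.Tc - C.T₀ := sub_pos.2 C.hT₀₂
  set k := C.MT / (c * (C.Tc - C.T₀)) with hk
  have hk0 : 0 < k := by positivity
  set g : ℝ → ℝ := fun T =>
    C.MT / k * (Real.exp (-k * (T - C.T₀)) - Real.exp (-k * (C.Tc - C.T₀))) with hg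
  have hgd : ∀ T, HasDerivAt g (-(C.MT * Real.exp (-k * (T - C.T₀)))) T := by
    intro T
    have h1 : HasDerivAt (fun T => -k * (T - C.T₀)) (-k) T := by
      simpa using ((hasDerivAt_id T).sub_const C.T₀).const_mul (-k)
    refine ((h1.exp.sub_const (Real.exp (-k * (C.Tc - C.T₀)))).const_mul
      (C.MT / k)).congr_deriv ?_
    field_simp
  have hpd : ∀ T ∈ Icc C.T₀ C.Tc, ∀ x,
      pderivT C (fun T _ => g T) T x = -(C.MT * Real.exp (-k * (T - C.T₀))) := fun T hT x =>
    (hgd T).hasDerivWithinAt.derivWithin (uniqueDiffOn_Icc C.hT₀₂ T hT)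
  have hg0 : ∀ T ∈ Icc C.T₀ C.Tc, 0 ≤ g T := by
    intro T hT
    have : Real.exp (-k * (C.Tc - C.T₀)) ≤ Real.exp (-k * (T - C.T₀)) :=
      Real.exp_le_exp.2 (by nlinarith [hT.2])
    exact mul_nonneg (by positivity) (by linarith)
  have hgle : ∀ T ∈ Icc C.T₀ C.Tc, g T ≤ c * (C.Tc - T) := by
    intro T hT
    have hconv : ConvexOn ℝ univ g := by
      have h1 : ConvexOn ℝ univ fun T => Real.exp (-k * (T - C.T₀)) := by
        refine ⟨convex_univ, fun x _ y _ s t hs ht hst => ?_⟩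
        have := convexOn_exp.2 (mem_univ (-k * (x - C.T₀))) (mem_univ (-k * (y - C.T₀))) hs ht hst
        refine le_trans (le_of_eq ?_) this
        simp only [smul_eq_mul]
        congr 1
        linear_combination (-k * C.T₀) * hst
      exact (h1.sub (concaveOn_const _ convex_univ)).smul (by positivity : 0 ≤ C.MT / k)
    have h := hconv.2 (mem_univ C.T₀) (mem_univ C.Tc)
      (div_nonneg (sub_nonneg.2 hT.2) hL.le) (div_nonneg (sub_nonneg.2 hT.1) hL.le)
      (by field_simp; ring)
    have hgTc : g C.Tc = 0 := by simp [hg]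
    have hgT₀ : g C.T₀ ≤ C.MT / k := by
      have := Real.exp_pos (-k * (C.Tc - C.T₀))
      have h0 : 0 < C.MT / k := by positivity
      simp only [hg, sub_self, mul_zero, Real.exp_zero]
      nlinarith
    have hMk : C.MT / k = c * (C.Tc - C.T₀) := by rw [hk]; field_simp
    simp only [smul_eq_mul, hgTc, mul_zero, add_zero] at h
    have hT' : (C.Tc - T) / (C.Tc - C.T₀) * C.T₀ + (T - C.T₀) / (C.Tc - C.T₀) * C.Tc = T := by
      field_simp
      ring
    rw [hT'] at h
    calc g T ≤ (C.Tc - T) / (C.Tc - C.T₀) * g C.T₀ := h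
      _ ≤ (C.Tc - T) / (C.Tc - C.T₀) * (c * (C.Tc - C.T₀)) := by
        have : 0 ≤ (C.Tc - T) / (C.Tc - C.T₀) := div_nonneg (sub_nonneg.2 hT.2) hL.le
        rw [← hMk]
        gcongr
      _ = c * (C.Tc - T) := by field_simp
  have ha := C.one_le_a
  refine ⟨fun T _ => g T, ⟨?_, ?_, ?_, ?_, ?_, ?_, ?_⟩, ?_⟩
  · have : ContDiff ℝ 2 g := by fun_prop
    exact (this.comp contDiff_fst).contDiffOn
  · intro T hT x _
    rw [C.Δ₁_eq_zero hT]
    exact ⟨by simpa using hg0 T hT, (hgle T hT).trans (hcle T hT)⟩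
  · intro x _
    simp [hg]
  · intro T hT x _ x₁ _
    have := hg0 T (Ico_subset_Icc_self hT)
    exact le_mul_of_one_le_left this ha
  · intro x _ x₁ _
    have hmem : C.Tc ∈ Icc C.T₀ C.Tc := right_mem_Icc.2 C.hT₀₂.le
    rw [hpd _ hmem, hpd _ hmem, neg_neg]
    exact le_mul_of_one_le_left (by positivity) ha
  · intro T hT x _
    rw [hpd T hT, neg_lt_zero]
    positivity
  · intro T hT x _
    rw [hpd T hT, neg_neg]
    refine mul_le_of_le_one_right hM.le (Real.exp_le_one_iff.2 ?_)
    nlinarith [hT.1]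
  · rw [hpd _ (left_mem_Icc.2 C.hT₀₂.le)]
    simp

end BCSContext

section MemW

variable {C : BCSContext} {f : ℝ → ℝ → ℝ}

theorem memW.continuousOn (hf : memW C f) :
    ContinuousOn (fun p : ℝ × ℝ => f p.1 p.2) (Icc C.T₀ C.Tc ×ˢ Icc C.eps C.om) :=
  hf.1.continuousOn

theorem memW.continuousOn_energy (hf : memW C f) {T : ℝ} (hT : T ∈ Icc C.T₀ C.Tc) :
    ContinuousOn (f T) (Icc C.eps C.om) :=
  hf.continuousOn.comp (f := fun ξ => (T, ξ)) (by fun_prop) fun _ hξ => ⟨hT, hξ⟩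

theorem memW.continuousOn_temperature (hf : memW C f) {x : ℝ} (hx : x ∈ Icc C.eps C.om) :
    ContinuousOn (fun T => f T x) (Icc C.T₀ C.Tc) :=
  hf.continuousOn.comp (f := fun T => (T, x)) (by fun_prop) fun _ hT => ⟨hT, hx⟩

theorem memW.hasDerivWithinAt_fderivWithin (hf : memW C f) {T x : ℝ}
    (hT : T ∈ Icc C.T₀ C.Tc) (hx : x ∈ Icc C.eps C.om) :
    HasDerivWithinAt (fun s => f s x)
      (fderivWithin ℝ (fun p : ℝ × ℝ => f p.1 p.2) C.Dset (T, x) (1, 0)) (Icc C.T₀ C.Tc) T := by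
  have h1 := ((hf.1.differentiableOn two_ne_zero) (T, x) ⟨hT, hx⟩).hasFDerivWithinAt
  have h2 : HasDerivWithinAt (fun s : ℝ => (s, x)) (1, 0) (Icc C.T₀ C.Tc) T :=
    (hasDerivWithinAt_id T _).prodMk (hasDerivWithinAt_const T _ x)
  have h3 : MapsTo (fun s : ℝ => (s, x)) (Icc C.T₀ C.Tc) C.Dset := fun _ hs => ⟨hs, hx⟩
  exact h1.comp_hasDerivWithinAt T h2 h3

theorem memW.pderivT_eq (hf : memW C f) {T x : ℝ}
    (hT : T ∈ Icc C.T₀ C.Tc) (hx : x ∈ Icc C.eps C.om) :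
    pderivT C f T x =
      fderivWithin ℝ (fun p : ℝ × ℝ => f p.1 p.2) C.Dset (T, x) (1, 0) :=
  (hf.hasDerivWithinAt_fderivWithin hT hx).derivWithin (uniqueDiffOn_Icc C.hT₀₂ T hT)

theorem memW.continuousOn_pderivT (hf : memW C f) {T : ℝ} (hT : T ∈ Icc C.T₀ C.Tc) :
    ContinuousOn (pderivT C f T) (Icc C.eps C.om) := by
  have h1 := hf.1.continuousOn_fderivWithin
    ((uniqueDiffOn_Icc C.hT₀₂).prod (uniqueDiffOn_Icc C.hepsom)) one_le_two
  have h2 : ContinuousOn (fun ξ => fderivWithin ℝ (fun p : ℝ × ℝ => f p.1 p.2) C.Dset (T, ξ))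
      (Icc C.eps C.om) :=
    h1.comp (f := fun ξ => (T, ξ)) (by fun_prop) fun _ hξ => ⟨hT, hξ⟩
  exact (h2.clm_apply continuousOn_const).congr fun ξ hξ => hf.pderivT_eq hT hξ

theorem memW.hasDerivAt (hf : memW C f) {T x : ℝ}
    (hT : T ∈ Ioo C.T₀ C.Tc) (hx : x ∈ Icc C.eps C.om) :
    HasDerivAt (fun s => f s x) (pderivT C f T x) T := by
  rw [hf.pderivT_eq (Ioo_subset_Icc_self hT) hx]
  exact (hf.hasDerivWithinAt_fderivWithin (Ioo_subset_Icc_self hT) hx).hasDerivAt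
    (Icc_mem_nhds hT.1 hT.2)

theorem memW.strictAntiOn (hf : memW C f) {x : ℝ} (hx : x ∈ Icc C.eps C.om) :
    StrictAntiOn (fun T => f T x) (Icc C.T₀ C.Tc) := by
  refine strictAntiOn_of_deriv_neg (convex_Icc _ _) (hf.continuousOn_temperature hx)
    fun T hT => ?_
  rw [interior_Icc] at hT
  rw [(hf.hasDerivAt hT hx).deriv]
  exact hf.2.2.2.2.2.1 T (Ioo_subset_Icc_self hT) x hx

theorem memW.pos (hf : memW C f) {T x : ℝ} (hT : T ∈ Ico C.T₀ C.Tc)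
    (hx : x ∈ Icc C.eps C.om) : 0 < f T x := by
  have := hf.strictAntiOn hx (Ico_subset_Icc_self hT) (right_mem_Icc.2 C.hT₀₂.le) hT.2
  simpa [hf.2.2.1 x hx] using this

theorem memW.nonneg (hf : memW C f) {T x : ℝ} (hT : T ∈ Icc C.T₀ C.Tc)
    (hx : x ∈ Icc C.eps C.om) : 0 ≤ f T x :=
  (sq_nonneg _).trans (hf.2.1 T hT x hx).1

theorem memW.le_Δ₂_zero_sq (hf : memW C f) {T x : ℝ} (hT : T ∈ Icc C.T₀ C.Tc)
    (hx : x ∈ Icc C.eps C.om) : f T x ≤ C.Δ₂ 0 ^ 2 := by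
  have h1 := C.Δ₂_le_Δ₂_zero hT
  have h2 := C.hΔ₂nonneg T
  exact (hf.2.1 T hT x hx).2.trans (by gcongr)

theorem memW.abs_pderivT_le (hf : memW C f) {T x : ℝ} (hT : T ∈ Icc C.T₀ C.Tc)
    (hx : x ∈ Icc C.eps C.om) : |pderivT C f T x| ≤ C.MT := by
  rw [abs_of_neg (hf.2.2.2.2.2.1 T hT x hx)]
  exact hf.2.2.2.2.2.2 T hT x hx

theorem BCSContext.continuousOn_U (C : BCSContext) {x : ℝ} (hx : x ∈ Icc C.eps C.om) :
    ContinuousOn (C.U x) (Icc C.eps C.om) :=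
  C.hUsmooth.continuousOn.comp (f := fun ξ => (x, ξ)) (by fun_prop) fun _ hξ => ⟨hx, hξ⟩

theorem opA_eq (T x : ℝ) :
    opA C f T x = (∫ ξ in C.eps..C.om, C.U x ξ * gapKernel ξ T (f T ξ)) ^ 2 := by
  simp only [opA, gapKernel, mul_assoc]

theorem memW.continuousOn_gapKernel (hf : memW C f) {T : ℝ} (hT : T ∈ Icc C.T₀ C.Tc) :
    ContinuousOn (fun ξ => gapKernel ξ T (f T ξ)) (Icc C.eps C.om) := by
  have h1 := hf.continuousOn_energy hT
  have h2 : ContinuousOn (fun ξ => Real.sqrt (ξ ^ 2 + f T ξ) / (2 * T)) (Icc C.eps C.om) :=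
    ((continuousOn_id.pow 2).add h1).sqrt.div_const _
  refine ContinuousOn.mul ?_ (Real.continuous_tanh.comp_continuousOn h2)
  refine (h1.div ((continuousOn_id.pow 2).add h1) fun ξ hξ => ?_).sqrt
  have := C.heps.trans_le hξ.1
  have := hf.nonneg hT hξ
  simp only [id, Pi.add_apply, Pi.pow_apply]
  positivity

theorem memW.continuousOn_gapKernelDeriv (hf : memW C f) {T : ℝ} (hT : T ∈ Ioo C.T₀ C.Tc) :
    ContinuousOn (fun ξ => gapKernelDeriv ξ T (f T ξ) (pderivT C f T ξ)) (Icc C.eps C.om) := by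
  have hT' := Ioo_subset_Icc_self hT
  have hT0 : 0 < T := C.T₀_pos.trans hT.1
  have h1 := hf.continuousOn_energy hT'
  have h2 : ContinuousOn (fun ξ => Real.sqrt (ξ ^ 2 + f T ξ)) (Icc C.eps C.om) :=
    ((continuousOn_id.pow 2).add h1).sqrt
  have h3 := Real.continuous_tanh.comp_continuousOn (h2.div_const (2 * T))
  have h4 := Real.continuous_cosh.comp_continuousOn (h2.div_const (2 * T))
  have hE : ∀ ξ ∈ Icc C.eps C.om, Real.sqrt (ξ ^ 2 + f T ξ) ≠ 0 := fun ξ hξ => by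
    have := hf.nonneg hT' hξ
    have := C.heps.trans_le hξ.1
    positivity
  have hc : ∀ ξ : ℝ, Real.cosh (Real.sqrt (ξ ^ 2 + f T ξ) / (2 * T)) ≠ 0 := fun ξ =>
    (Real.cosh_pos _).ne'
  refine ((((hf.continuousOn_pderivT hT').div (continuousOn_const.mul h1.sqrt) ?_).mul
    ((((continuousOn_id.pow 2).mul h3).div (h2.pow 3) ?_).add
      (h1.div ((continuousOn_const.mul (h2.pow 2)).mul (h4.pow 2)) ?_))).sub
    (h1.sqrt.div (continuousOn_const.mul (h4.pow 2)) ?_))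
  · intro ξ hξ
    have := hf.pos (Ioo_subset_Ico_self hT) hξ
    exact mul_ne_zero two_ne_zero (Real.sqrt_pos.2 this).ne'
  · exact fun ξ hξ => pow_ne_zero 3 (hE ξ hξ)
  · exact fun ξ hξ => mul_ne_zero (mul_ne_zero (by positivity) (pow_ne_zero 2 (hE ξ hξ)))
      (pow_ne_zero 2 (hc ξ))
  · exact fun ξ hξ => mul_ne_zero (by positivity) (pow_ne_zero 2 (hc ξ))

theorem BCSContext.abs_U_le (C : BCSContext) {x ξ : ℝ} (hx : x ∈ Icc C.eps C.om)
    (hξ : ξ ∈ Icc C.eps C.om) : |C.U x ξ| ≤ C.U₂ := by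
  rw [abs_of_nonneg (C.hU₁pos.le.trans (C.hUlb x hx ξ hξ))]
  exact C.hUub x hx ξ hξ

theorem memW.continuousOn_opA (hf : memW C f) {x : ℝ} (hx : x ∈ Icc C.eps C.om) :
    ContinuousOn (fun T => opA C f T x) (Icc C.T₀ C.Tc) := by
  simp only [opA_eq]
  refine ContinuousOn.pow (fun T hT => ?_) 2
  have hI : uIoc C.eps C.om ⊆ Icc C.eps C.om := by
    rw [uIoc_of_le C.hepsom.le]; exact Ioc_subset_Icc_self
  refine intervalIntegral.continuousWithinAt_of_dominated_interval (bound := fun _ => C.U₂ * 1)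
    ?_ ?_ intervalIntegrable_const (ae_of_all _ fun ξ hξ => ?_)
  · filter_upwards [self_mem_nhdsWithin] with s hs
    exact (((C.continuousOn_U hx).mul (hf.continuousOn_gapKernel hs)).mono hI).aestronglyMeasurable
      measurableSet_uIoc
  · filter_upwards [self_mem_nhdsWithin] with s hs
    refine ae_of_all _ fun ξ hξ => ?_
    have hs0 : 0 < s := C.T₀_pos.trans_le hs.1
    rw [Real.norm_eq_abs, abs_mul, abs_of_nonneg (gapKernel_nonneg hs0)]
    exact mul_le_mul (C.abs_U_le hx (hI hξ)) (gapKernel_le_one (hf.nonneg hs (hI hξ)) hs0)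
      (gapKernel_nonneg hs0) C.U₂_pos.le
  · have h1 : ContinuousWithinAt (fun s => f s ξ) (Icc C.T₀ C.Tc) T :=
      hf.continuousOn_temperature (hI hξ) T hT
    have h2 : ContinuousWithinAt (fun s => ξ ^ 2 + f s ξ) (Icc C.T₀ C.Tc) T :=
      continuousWithinAt_const.add h1
    have hT0 : 0 < T := C.T₀_pos.trans_le hT.1
    have hξ0 : 0 < ξ := C.heps.trans_le (hI hξ).1
    have hf0 := hf.nonneg hT (hI hξ)
    refine continuousWithinAt_const.mul (ContinuousWithinAt.mul ?_ ?_)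
    · exact (h1.div h2 (by positivity)).sqrt
    · refine Real.continuous_tanh.continuousAt.comp_continuousWithinAt ?_
      exact h2.sqrt.div (by fun_prop) (by positivity)

theorem memW.hasDerivAt_integral (hf : memW C f) {T x : ℝ} (hT : T ∈ Ioo C.T₀ C.Tc)
    (hx : x ∈ Icc C.eps C.om) :
    HasDerivAt (fun s => ∫ ξ in C.eps..C.om, C.U x ξ * gapKernel ξ s (f s ξ))
      (∫ ξ in C.eps..C.om, C.U x ξ * gapKernelDeriv ξ T (f T ξ) (pderivT C f T ξ)) T := by
  have hI : uIoc C.eps C.om ⊆ Icc C.eps C.om := by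
    rw [uIoc_of_le C.hepsom.le]; exact Ioc_subset_Icc_self
  obtain ⟨T', hTT', hT'⟩ := exists_between hT.2
  have hT'mem : T' ∈ Ico C.T₀ C.Tc := ⟨(hT.1.trans hTT').le, hT'⟩
  obtain ⟨ξ₀, hξ₀, hmin⟩ := isCompact_Icc.exists_isMinOn (nonempty_Icc.2 C.hepsom.le)
    (hf.continuousOn_energy (Ico_subset_Icc_self hT'mem))
  have hm : 0 < f T' ξ₀ := hf.pos hT'mem hξ₀
  have hsub : Ioo C.T₀ T' ⊆ Ioo C.T₀ C.Tc := Ioo_subset_Ioo_right hT'.le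
  refine (intervalIntegral.hasDerivAt_integral_of_dominated_loc_of_deriv_le
    (F' := fun s ξ => C.U x ξ * gapKernelDeriv ξ s (f s ξ) (pderivT C f s ξ))
    (s := Ioo C.T₀ T') (bound := fun _ => C.U₂ * (C.MT / (2 * Real.sqrt (f T' ξ₀)) *
      (1 / C.eps + 1 / (2 * C.T₀)) + Real.sqrt (C.Δ₂ 0 ^ 2) / (2 * C.T₀ ^ 2)))
    (Ioo_mem_nhds hT.1 hTT') ?_ ?_ ?_ (ae_of_all _ fun ξ hξ s hs => ?_)
    intervalIntegrable_const (ae_of_all _ fun ξ hξ s hs => ?_)).2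
  · filter_upwards [Ioo_mem_nhds hT.1 hT.2] with s hs
    exact (((C.continuousOn_U hx).mul (hf.continuousOn_gapKernel
      (Ioo_subset_Icc_self hs))).mono hI).aestronglyMeasurable measurableSet_uIoc
  · exact ((C.continuousOn_U hx).mul (hf.continuousOn_gapKernel
      (Ioo_subset_Icc_self hT))).intervalIntegrable_of_Icc C.hepsom.le
  · exact (((C.continuousOn_U hx).mul (hf.continuousOn_gapKernelDeriv hT)).mono
      hI).aestronglyMeasurable measurableSet_uIoc
  · have hs' := Ioo_subset_Icc_self (hsub hs)
    rw [Real.norm_eq_abs, abs_mul]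
    refine mul_le_mul (C.abs_U_le hx (hI hξ)) ?_ (abs_nonneg _) C.U₂_pos.le
    refine abs_gapKernelDeriv_le C.heps (hI hξ).1 C.T₀_pos hs.1.le hm ?_
      (hf.le_Δ₂_zero_sq hs' (hI hξ)) (hf.abs_pderivT_le hs' (hI hξ))
    exact (hmin (hI hξ)).trans ((hf.strictAntiOn (hI hξ)).antitoneOn hs'
      (Ico_subset_Icc_self hT'mem) hs.2.le)
  · have hs' := hsub hs
    exact (hasDerivAt_gapKernel (hf.hasDerivAt hs' (hI hξ))
      (hf.pos (Ioo_subset_Ico_self hs') (hI hξ)) (C.T₀_pos.trans hs.1)).const_mul _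

/-- The gap condition in the form `√a K² ≤ 1`. -/
theorem gapCondition.sqrt_mul_sq_le (hcond : gapCondition C) {T x : ℝ}
    (hT : T ∈ Icc C.T₀ C.Tc) (hx : x ∈ Icc C.eps C.om) :
    Real.sqrt C.a *
      (∫ ξ in C.eps..C.om, C.U x ξ * (Real.tanh (ξ / (2 * T)) / ξ)) ^ 2 ≤ 1 := by
  have h := hcond T hT x hx
  have ha : 0 < C.a := one_pos.trans_le C.one_le_a
  have hT0 : 0 < T := C.T₀_pos.trans_le hT.1
  have heq : (fun ξ => C.U x ξ / ξ * Real.tanh (ξ / (2 * T))) =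
      fun ξ => C.U x ξ * (Real.tanh (ξ / (2 * T)) / ξ) := by
    funext ξ; ring
  rw [heq] at h
  have hK : 0 ≤ ∫ ξ in C.eps..C.om, C.U x ξ * (Real.tanh (ξ / (2 * T)) / ξ) := by
    refine intervalIntegral.integral_nonneg C.hepsom.le fun ξ hξ => ?_
    have hξ0 : 0 < ξ := C.heps.trans_le hξ.1
    exact mul_nonneg (C.hU₁pos.le.trans (C.hUlb x hx ξ hξ))
      (div_nonneg (Real.tanh_nonneg (by positivity)) hξ0.le)
  have hs : Real.sqrt C.a = (C.a ^ ((1 : ℝ) / 4)) ^ 2 := by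
    rw [Real.sqrt_eq_rpow, ← Real.rpow_natCast, ← Real.rpow_mul ha.le]
    norm_num
  rw [hs, ← mul_pow]
  exact pow_le_one₀ (mul_nonneg (Real.rpow_nonneg ha.le _) hK) h

theorem BCSContext.integral_inv_sq_le (C : BCSContext) :
    ∫ ξ in C.eps..C.om, (ξ ^ 2)⁻¹ ≤ 1 / C.eps := by
  have hε := C.heps
  have hom : 0 < C.om := hε.trans C.hepsom
  have hd : ∀ ξ ∈ uIcc C.eps C.om, HasDerivAt (fun ξ : ℝ => -ξ⁻¹) (ξ ^ 2)⁻¹ ξ := by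
    intro ξ hξ
    rw [uIcc_of_le C.hepsom.le] at hξ
    exact HasDerivAt.congr_deriv (f := fun ξ : ℝ => -ξ⁻¹)
      (hasDerivAt_inv (hε.trans_le hξ.1).ne').neg (neg_neg _)
  have hc : ContinuousOn (fun ξ : ℝ => (ξ ^ 2)⁻¹) (Icc C.eps C.om) :=
    (by fun_prop : ContinuousOn (fun ξ : ℝ => ξ ^ 2) (Icc C.eps C.om)).inv₀ fun ξ hξ =>
      pow_ne_zero 2 (hε.trans_le hξ.1).ne'
  rw [intervalIntegral.integral_eq_sub_of_hasDerivAt hd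
    (hc.intervalIntegrable_of_Icc C.hepsom.le), one_div]
  have : 0 < C.om⁻¹ := by positivity
  linarith

theorem memW.neg_integral_gapKernelDeriv_le (hf : memW C f) {T x m M : ℝ}
    (hT : T ∈ Ioo C.T₀ C.Tc) (hx : x ∈ Icc C.eps C.om) (hm : 0 < m)
    (hmf : ∀ ξ ∈ Icc C.eps C.om, m ≤ f T ξ) (hfM : ∀ ξ ∈ Icc C.eps C.om, f T ξ ≤ M)
    (hMm : M ≤ C.a * m) :
    -(∫ ξ in C.eps..C.om, C.U x ξ * gapKernelDeriv ξ T (f T ξ) (pderivT C f T ξ)) ≤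
      C.MT / (2 * Real.sqrt m) *
        ∫ ξ in C.eps..C.om, C.U x ξ * (Real.tanh (ξ / (2 * T)) / ξ) := by
  have hε := C.heps
  have hT' := Ioo_subset_Icc_self hT
  have hT0 : 0 < T := C.T₀_pos.trans hT.1
  have ha := C.one_le_a
  have hU₂ := C.U₂_pos
  have hMT := C.MT_pos
  have hr : 0 < Real.sqrt m := Real.sqrt_pos.2 hm
  set G := tanhDefect (C.eps / (2 * C.Tc)) with hG
  have hG0 : 0 < G := C.tanhDefect_eps_pos
  set A := C.MT / (2 * Real.sqrt m)
  set b := C.MT * Real.sqrt m / 2 * G with hb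
  set c := 2 * Real.sqrt M * C.Mz ^ 2 with hc
  have hpt : ∀ ξ ∈ Icc C.eps C.om,
      -(C.U x ξ * gapKernelDeriv ξ T (f T ξ) (pderivT C f T ξ)) ≤
        A * (C.U x ξ * (Real.tanh (ξ / (2 * T)) / ξ)) -
          C.U₁ * b * (ξ ^ 2 + C.Δ₂ 0 ^ 2) ^ (-(3 : ℝ) / 2) + C.U₂ * c * (ξ ^ 2)⁻¹ := by
    intro ξ hξ
    have h : -gapKernelDeriv ξ T (f T ξ) (pderivT C f T ξ) ≤
        A * (Real.tanh (ξ / (2 * T)) / ξ) - b * (ξ ^ 2 + C.Δ₂ 0 ^ 2) ^ (-(3 : ℝ) / 2) +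
          c * (ξ ^ 2)⁻¹ := neg_gapKernelDeriv_le hε hξ.1 hT0 hT.2.le hm (hmf ξ hξ) (hfM ξ hξ)
      (hf.le_Δ₂_zero_sq hT' hξ) (hf.2.2.2.2.2.2 T hT' ξ hξ) hMT.le fun z hz => C.div_cosh_le_Mz hz
    have hU1 := C.hUlb x hx ξ hξ
    have hU2 := C.hUub x hx ξ hξ
    have hU0 : 0 ≤ C.U x ξ := C.hU₁pos.le.trans hU1
    have hP : 0 ≤ b * (ξ ^ 2 + C.Δ₂ 0 ^ 2) ^ (-(3 : ℝ) / 2) := by positivity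
    have hQ : 0 ≤ c * (ξ ^ 2)⁻¹ := by positivity
    have h1 := mul_le_mul_of_nonneg_left h hU0
    have h2 := mul_le_mul_of_nonneg_right hU1 hP
    have h3 := mul_le_mul_of_nonneg_right hU2 hQ
    linarith
  have hi0 : IntervalIntegrable
      (fun ξ => C.U x ξ * gapKernelDeriv ξ T (f T ξ) (pderivT C f T ξ)) volume C.eps C.om :=
    ((C.continuousOn_U hx).mul (hf.continuousOn_gapKernelDeriv hT)).intervalIntegrable_of_Icc
      C.hepsom.le
  have hi1 : IntervalIntegrable (fun ξ => A * (C.U x ξ * (Real.tanh (ξ / (2 * T)) / ξ)))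
      volume C.eps C.om := by
    refine (ContinuousOn.intervalIntegrable_of_Icc C.hepsom.le ?_).const_mul A
    refine (C.continuousOn_U hx).mul (ContinuousOn.div
      (Real.continuous_tanh.comp (by fun_prop)).continuousOn continuousOn_id fun ξ hξ => ?_)
    exact (hε.trans_le hξ.1).ne'
  have hi2 : IntervalIntegrable (fun ξ => C.U₁ * b * (ξ ^ 2 + C.Δ₂ 0 ^ 2) ^ (-(3 : ℝ) / 2))
      volume C.eps C.om :=
    ((C.continuousOn_rpow_neg _ (sq_nonneg _)).intervalIntegrable_of_Icc C.hepsom.le).const_mul _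
  have hi3 : IntervalIntegrable (fun ξ : ℝ => C.U₂ * c * (ξ ^ 2)⁻¹) volume C.eps C.om := by
    refine (ContinuousOn.intervalIntegrable_of_Icc C.hepsom.le ?_).const_mul _
    exact (by fun_prop : ContinuousOn (fun ξ : ℝ => ξ ^ 2) (Icc C.eps C.om)).inv₀ fun ξ hξ =>
      pow_ne_zero 2 (hε.trans_le hξ.1).ne'
  have hmono := intervalIntegral.integral_mono_on C.hepsom.le hi0.neg ((hi1.sub hi2).add hi3) hpt
  simp only [Pi.neg_apply] at hmono
  rw [intervalIntegral.integral_neg, intervalIntegral.integral_add (hi1.sub hi2) hi3,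
    intervalIntegral.integral_sub hi1 hi2, intervalIntegral.integral_const_mul,
    intervalIntegral.integral_const_mul, intervalIntegral.integral_const_mul] at hmono
  have hbeq : C.U₁ * b * (∫ ξ in C.eps..C.om, (ξ ^ 2 + C.Δ₂ 0 ^ 2) ^ (-(3 : ℝ) / 2)) =
      C.U₂ * (2 * (C.a * Real.sqrt m) * C.Mz ^ 2) * (1 / C.eps) := by
    have h := C.MT_mul_eq
    rw [← hG] at h
    rw [hb, mul_one_div, eq_div_iff hε.ne']
    linear_combination (Real.sqrt m / 2) * h
  have hcle : C.U₂ * c * (∫ ξ in C.eps..C.om, (ξ ^ 2)⁻¹) ≤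
      C.U₂ * (2 * (C.a * Real.sqrt m) * C.Mz ^ 2) * (1 / C.eps) := by
    have hM : Real.sqrt M ≤ C.a * Real.sqrt m := by
      refine Real.sqrt_le_iff.2 ⟨by positivity, ?_⟩
      rw [mul_pow, Real.sq_sqrt hm.le]
      nlinarith [mul_nonneg (sub_nonneg.2 ha) hm.le]
    have hI := C.integral_inv_sq_le
    have hI0 : 0 ≤ ∫ ξ in C.eps..C.om, (ξ ^ 2)⁻¹ :=
      intervalIntegral.integral_nonneg C.hepsom.le fun ξ _ => by positivity
    rw [hc]
    gcongr
  linarith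

theorem memW.hasDerivAt_opA (hf : memW C f) {T x : ℝ} (hT : T ∈ Ioo C.T₀ C.Tc)
    (hx : x ∈ Icc C.eps C.om) :
    HasDerivAt (fun s => opA C f s x)
      (2 * (∫ ξ in C.eps..C.om, C.U x ξ * gapKernel ξ T (f T ξ)) *
        ∫ ξ in C.eps..C.om, C.U x ξ * gapKernelDeriv ξ T (f T ξ) (pderivT C f T ξ)) T := by
  simp only [opA_eq]
  refine HasDerivAt.congr_deriv
    (f := fun s => (∫ ξ in C.eps..C.om, C.U x ξ * gapKernel ξ s (f s ξ)) ^ 2)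
    ((hf.hasDerivAt_integral hT hx).pow 2) ?_
  simp

theorem memW.neg_deriv_opA_le (hf : memW C f) (hcond : gapCondition C) {T x : ℝ}
    (hT : T ∈ Ioo C.T₀ C.Tc) (hx : x ∈ Icc C.eps C.om) :
    -deriv (fun s => opA C f s x) T ≤ C.MT := by
  rw [(hf.hasDerivAt_opA hT hx).deriv]
  have hT' := Ioo_subset_Icc_self hT
  have hT0 : 0 < T := C.T₀_pos.trans hT.1
  have hne := nonempty_Icc.2 C.hepsom.le
  obtain ⟨ξ₀, hξ₀, hmin⟩ := isCompact_Icc.exists_isMinOn hne (hf.continuousOn_energy hT')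
  obtain ⟨ξ₁, hξ₁, hmax⟩ := isCompact_Icc.exists_isMaxOn hne (hf.continuousOn_energy hT')
  have hm : 0 < f T ξ₀ := hf.pos (Ioo_subset_Ico_self hT) hξ₀
  have hMm := hf.2.2.2.1 T (Ioo_subset_Ico_self hT) ξ₁ hξ₁ ξ₀ hξ₀
  have hD := hf.neg_integral_gapKernelDeriv_le hT hx hm (fun ξ hξ => hmin hξ)
    (fun ξ hξ => hmax hξ) hMm
  have hsK := hcond.sqrt_mul_sq_le hT' hx
  have hMT := C.MT_pos
  set D := ∫ ξ in C.eps..C.om, C.U x ξ * gapKernelDeriv ξ T (f T ξ) (pderivT C f T ξ)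
  set K := ∫ ξ in C.eps..C.om, C.U x ξ * (Real.tanh (ξ / (2 * T)) / ξ) with hK
  have hU0 : ∀ ξ ∈ Icc C.eps C.om, 0 ≤ C.U x ξ := fun ξ hξ =>
    C.hU₁pos.le.trans (C.hUlb x hx ξ hξ)
  have hH0 : 0 ≤ ∫ ξ in C.eps..C.om, C.U x ξ * gapKernel ξ T (f T ξ) :=
    intervalIntegral.integral_nonneg C.hepsom.le fun ξ hξ =>
      mul_nonneg (hU0 ξ hξ) (gapKernel_nonneg hT0)
  have hH : ∫ ξ in C.eps..C.om, C.U x ξ * gapKernel ξ T (f T ξ) ≤ Real.sqrt (f T ξ₁) * K := by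
    rw [hK, ← intervalIntegral.integral_const_mul]
    refine intervalIntegral.integral_mono_on C.hepsom.le
      (((C.continuousOn_U hx).mul (hf.continuousOn_gapKernel hT')).intervalIntegrable_of_Icc
        C.hepsom.le) (ContinuousOn.intervalIntegrable_of_Icc C.hepsom.le ?_) fun ξ hξ => ?_
    · refine continuousOn_const.mul ((C.continuousOn_U hx).mul (ContinuousOn.div
        (Real.continuous_tanh.comp (by fun_prop)).continuousOn continuousOn_id fun ξ hξ => ?_))
      exact (C.heps.trans_le hξ.1).ne'
    · have := mul_le_mul_of_nonneg_left (gapKernel_le (C.heps.trans_le hξ.1) hT0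
        (hf.nonneg hT' hξ) (hmax hξ)) (hU0 ξ hξ)
      linarith
  set H := ∫ ξ in C.eps..C.om, C.U x ξ * gapKernel ξ T (f T ξ)
  have hr : 0 < Real.sqrt (f T ξ₀) := Real.sqrt_pos.2 hm
  have hR : 0 < Real.sqrt (f T ξ₁) := hr.trans_le (Real.sqrt_le_sqrt (hmin hξ₁))
  have hK0 : 0 ≤ K := nonneg_of_mul_nonneg_right (hH0.trans hH) hR
  have hsq : Real.sqrt (f T ξ₁) ≤ Real.sqrt C.a * Real.sqrt (f T ξ₀) := by
    rw [← Real.sqrt_mul (zero_le_one.trans C.one_le_a)]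
    exact Real.sqrt_le_sqrt hMm
  calc -(2 * H * D) = 2 * H * (-D) := by ring
    _ ≤ 2 * H * (C.MT / (2 * Real.sqrt (f T ξ₀)) * K) := by gcongr
    _ ≤ 2 * (Real.sqrt C.a * Real.sqrt (f T ξ₀) * K) *
        (C.MT / (2 * Real.sqrt (f T ξ₀)) * K) := by
      have : H ≤ Real.sqrt C.a * Real.sqrt (f T ξ₀) * K := hH.trans (by gcongr)
      gcongr
    _ = C.MT * (Real.sqrt C.a * K ^ 2) := by field_simp
    _ ≤ C.MT := mul_le_of_le_one_right hMT.le hsK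

theorem memW.neg_pderivT_opA_le (hf : memW C f) (hcond : gapCondition C) {T x : ℝ}
    (hx : x ∈ Icc C.eps C.om) :
    -(pderivT C (opA C f) T x) ≤ C.MT := by
  have hmono : MonotoneOn (fun s => opA C f s x + C.MT * s) (Icc C.T₀ C.Tc) := by
    have hd : ∀ s ∈ Ioo C.T₀ C.Tc, HasDerivAt (fun s => opA C f s x + C.MT * s)
        (deriv (fun s => opA C f s x) s + C.MT) s := fun s hs => by
      exact HasDerivAt.congr_deriv (f := fun s => opA C f s x + C.MT * s)
        ((hf.hasDerivAt_opA hs hx).differentiableAt.hasDerivAt.add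
          ((hasDerivAt_id s).const_mul C.MT)) (by rw [mul_one])
    refine monotoneOn_of_deriv_nonneg (convex_Icc _ _)
      ((hf.continuousOn_opA hx).add (by fun_prop)) ?_ ?_ <;> rw [interior_Icc]
    · exact fun s hs => (hd s hs).differentiableAt.differentiableWithinAt
    · intro s hs
      rw [(hd s hs).deriv]
      linarith [hf.neg_deriv_opA_le hcond hs hx]
  by_cases hdiff : DifferentiableWithinAt ℝ (fun s => opA C f s x) (Icc C.T₀ C.Tc) T
  · have h := hmono.derivWithin_nonneg (x := T)
    by_cases hu : UniqueDiffWithinAt ℝ (Icc C.T₀ C.Tc) T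
    · have h1 : HasDerivWithinAt (fun s => opA C f s x + C.MT * s)
          (pderivT C (opA C f) T x + C.MT * 1) (Icc C.T₀ C.Tc) T :=
        hdiff.hasDerivWithinAt.add ((hasDerivWithinAt_id T _).const_mul C.MT)
      rw [h1.derivWithin hu] at h
      linarith
    · rw [pderivT, derivWithin_zero_of_not_uniqueDiffWithinAt hu, neg_zero]
      exact C.MT_pos.le
  · rw [pderivT, derivWithin_zero_of_not_differentiableWithinAt hdiff, neg_zero]
    exact C.MT_pos.le

end MemW

theorem stmt_11 (C : BCSContext) (hcond : gapCondition C) :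
    sSup {y : ℝ | ∃ f : ℝ → ℝ → ℝ, memW C f ∧ ∃ T ∈ Icc C.T₀ C.Tc, ∃ x ∈ C.Iset,
        y = -(pderivT C (opA C f) T x)} ≤
      sSup {y : ℝ | ∃ f : ℝ → ℝ → ℝ, memW C f ∧ ∃ T ∈ Icc C.T₀ C.Tc, ∃ x ∈ C.Iset,
        y = -(pderivT C f T x)} ∧
    sSup {y : ℝ | ∃ f : ℝ → ℝ → ℝ, memW C f ∧ ∃ T ∈ Icc C.T₀ C.Tc, ∃ x ∈ C.Iset,
        y = -(pderivT C f T x)} = C.MT := by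
  obtain ⟨g, hg, hgMT⟩ := C.exists_memW_slope_eq_MT
  have hT₀ : C.T₀ ∈ Icc C.T₀ C.Tc := left_mem_Icc.2 C.hT₀₂.le
  have hmax : IsGreatest {y : ℝ | ∃ f : ℝ → ℝ → ℝ, memW C f ∧ ∃ T ∈ Icc C.T₀ C.Tc,
      ∃ x ∈ C.Iset, y = -(pderivT C f T x)} C.MT := by
    refine ⟨⟨g, hg, C.T₀, hT₀, C.eps, C.eps_mem, hgMT.symm⟩, ?_⟩
    rintro y ⟨f, hf, T, hT, x, hx, rfl⟩
    exact hf.2.2.2.2.2.2 T hT x hx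
  refine ⟨?_, hmax.csSup_eq⟩
  rw [hmax.csSup_eq]
  refine csSup_le ⟨_, g, hg, C.T₀, hT₀, C.eps, C.eps_mem, rfl⟩ ?_
  rintro y ⟨f, hf, T, -, x, hx, rfl⟩
  exact hf.neg_pderivT_opA_le hcond hx

end
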